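/- arXiv:1401.2565 — 3 statements merged into one kernel-verified Lean document; each statement's English description precedes it below -/
import Mathlib

section
/- Let n ≥ 4 be an integer and a, b real numbers with a² < b². Let L : ℝⁿ → ℝ^{n+2} be immersion (B): with S = sinh x_{n−2}, C = cosh x_{n−2}, P = ∏_{j=1}^{n−3} cosh x_j, ρ = x_{n−1}² + x_n², the coordinates are u₁ = [a(b⁴−4+4b²ρ)S + b(b⁴+4+4b²ρ)C]P/(4b³); u₂ = [a(b⁴+4−4b²ρ)S + b(b⁴−4−4b²ρ)C]P/(4b³); u_{k+2} = sinh(x_k)∏_{j=1}^{k−1} cosh x_j for 1 ≤ k ≤ n−3; u_n = (√(b²−a²)/b) S P; u_{n+1} = (aS+bC)x_{n−1}P; u_{n+2} = (aS+bC)x_nP. Then for every x ∈ ℝⁿ: η(∂L/∂x_i(x), ∂L/∂x_j(x)) = 0 for i ≠ j; η(∂L/∂x₁, ∂L/∂x₁) = 1; η(∂L/∂x_k, ∂L/∂x_k) = ∏_{j=1}^{k−1} cosh²x_j for 2 ≤ k ≤ n−2; and η(∂L/∂x_{n−1}, ∂L/∂x_{n−1}) = η(∂L/∂x_n, ∂L/∂x_n)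 = (aS+bC)² P². In particular L induces the warped-product metric dx₁² + cosh²x₁ dx₂² + ⋯ + (∏_{j=1}^{n−3} cosh²x_j) dx_{n−2}² + (a sinh x_{n−2} + b cosh x_{n−2})²(∏_{j=1}^{n−3} cosh²x_j)(dx_{n−1}² + dx_n²) wherever this form is positive definite. -/
open Real

/-- The Minkowski (Lorentzian) bilinear form `η(u,v) = -u₁v₁ + Σ_{j≥2} uⱼvⱼ` on `ℝ^{N+1}`. -/
noncomputable def eta {N : ℕ} (u v : EuclideanSpace ℝ (Fin (N + 1))) : ℝ :=
  -(u 0 * v 0) + ∑ j : Fin N, u j.succ * v j.succ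

/-- Partial derivative of `L` at `x` in the direction of the `i`-th standard basis vector,
in the sense of the Fréchet derivative. -/
noncomputable def pd {n : ℕ} {F : Type*} [NormedAddCommGroup F] [NormedSpace ℝ F]
    (L : EuclideanSpace ℝ (Fin n) → F) (x : EuclideanSpace ℝ (Fin n)) (i : Fin n) : F :=
  fderiv ℝ L x (EuclideanSpace.single i 1)

/-- The product `∏_{j<k} cosh (p j)`. -/
noncomputable def coshProd (p : ℕ → ℝ) (k : ℕ) : ℝ := ∏ j ∈ Finset.range k, Real.cosh (p j)

/-- The differential of `coshProd` at `p` in the direction `v`. -/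
noncomputable def coshProdDiff (p v : ℕ → ℝ) : ℕ → ℝ
  | 0 => 0
  | k + 1 => coshProdDiff p v k * Real.cosh (p k) + coshProd p k * (Real.sinh (p k) * v k)

/-- The function `a sinh t + b cosh t`. -/
noncomputable def warping (a b t : ℝ) : ℝ := a * Real.sinh t + b * Real.cosh t

/-- The null coordinate `(u₁ - u₂) / (2P)` of the immersion. -/
noncomputable def nullCoord (a b t y z : ℝ) : ℝ :=
  (b * Real.cosh t - a * Real.sinh t) / b ^ 3 + (y ^ 2 + z ^ 2) * warping a b t / b

/-- The differential of `nullCoord` at `(t, y, z)` in the direction `(t', y', z')`. -/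
noncomputable def nullCoordDiff (a b t y z t' y' z' : ℝ) : ℝ :=
  (b * Real.sinh t - a * Real.cosh t) * t' / b ^ 3 +
    ((2 * y * y' + 2 * z * z') * warping a b t + (y ^ 2 + z ^ 2) * (warping b a t * t')) / b

/-- The coordinates of the immersion, as functions of a sequence of parameters. -/
noncomputable def immersionCoord (a b : ℝ) (m : ℕ) (p : ℕ → ℝ) (k : ℕ) : ℝ :=
  if k = 0 then
    coshProd p m *
      (b / 4 * warping a b (p m) + nullCoord a b (p m) (p (m + 1)) (p (m + 2)))
  else if k = 1 then
    coshProd p m *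
      (b / 4 * warping a b (p m) - nullCoord a b (p m) (p (m + 1)) (p (m + 2)))
  else if k ≤ m + 1 then coshProd p (k - 2) * Real.sinh (p (k - 2))
  else if k = m + 2 then coshProd p m * (√(b ^ 2 - a ^ 2) / b * Real.sinh (p m))
  else if k = m + 3 then coshProd p m * (warping a b (p m) * p (m + 1))
  else coshProd p m * (warping a b (p m) * p (m + 2))

/-- The differential of `immersionCoord` at `p` in the direction `v`. -/
noncomputable def immersionCoordDiff (a b : ℝ) (m : ℕ) (p v : ℕ → ℝ) (k : ℕ) : ℝ :=
  if k = 0 then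
    coshProdDiff p v m *
        (b / 4 * warping a b (p m) + nullCoord a b (p m) (p (m + 1)) (p (m + 2))) +
      coshProd p m * (b / 4 * (warping b a (p m) * v m) +
        nullCoordDiff a b (p m) (p (m + 1)) (p (m + 2)) (v m) (v (m + 1)) (v (m + 2)))
  else if k = 1 then
    coshProdDiff p v m *
        (b / 4 * warping a b (p m) - nullCoord a b (p m) (p (m + 1)) (p (m + 2))) +
      coshProd p m * (b / 4 * (warping b a (p m) * v m) -
        nullCoordDiff a b (p m) (p (m + 1)) (p (m + 2)) (v m) (v (m + 1)) (v (m + 2)))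
  else if k ≤ m + 1 then
    coshProdDiff p v (k - 2) * Real.sinh (p (k - 2)) +
      coshProd p (k - 2) * (Real.cosh (p (k - 2)) * v (k - 2))
  else if k = m + 2 then
    coshProdDiff p v m * (√(b ^ 2 - a ^ 2) / b * Real.sinh (p m)) +
      coshProd p m * (√(b ^ 2 - a ^ 2) / b * (Real.cosh (p m) * v m))
  else if k = m + 3 then
    coshProdDiff p v m * (warping a b (p m) * p (m + 1)) +
      coshProd p m * (warping b a (p m) * v m * p (m + 1) + warping a b (p m) * v (m + 1))
  else
    coshProdDiff p v m * (warping a b (p m) * p (m + 2)) +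
      coshProd p m * (warping b a (p m) * v m * p (m + 2) + warping a b (p m) * v (m + 2))

/-- The diagonal coefficients of the induced warped-product metric. -/
noncomputable def metricCoeff (a b : ℝ) (m : ℕ) (p : ℕ → ℝ) (k : ℕ) : ℝ :=
  if k ≤ m then coshProd p k ^ 2 else warping a b (p m) ^ 2 * coshProd p m ^ 2

/-- The extension by zero of a vector to a sequence. -/
noncomputable def extendZero {n : ℕ} (x : EuclideanSpace ℝ (Fin n)) (j : ℕ) : ℝ :=
  if h : j < n then x ⟨j, h⟩ else 0

theorem hasDerivAt_coshProd {p : ℝ → ℕ → ℝ} {v : ℕ → ℝ} {s : ℝ}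
    (hp : ∀ j, HasDerivAt (fun t => p t j) (v j) s) (k : ℕ) :
    HasDerivAt (fun t => coshProd (p t) k) (coshProdDiff (p s) v k) s := by
  induction k with
  | zero => simpa [coshProd, coshProdDiff] using hasDerivAt_const s (1 : ℝ)
  | succ k ih =>
    have h := ih.mul (hp k).cosh
    simp only [coshProdDiff]
    refine h.congr_of_eventuallyEq (.of_forall fun t => ?_)
    simp [coshProd, Finset.prod_range_succ]

theorem hasDerivAt_warping {a b s : ℝ} {f : ℝ → ℝ} {f' : ℝ} (hf : HasDerivAt f f' s) :
    HasDerivAt (fun t => warping a b (f t)) (warping b a (f s) * f') s := by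
  have h := (hf.sinh.const_mul a).add (hf.cosh.const_mul b)
  refine h.congr_deriv ?_
  simp only [warping]
  ring

theorem hasDerivAt_nullCoord {a b s : ℝ} {f g h : ℝ → ℝ} {f' g' h' : ℝ}
    (hf : HasDerivAt f f' s) (hg : HasDerivAt g g' s) (hh : HasDerivAt h h' s) :
    HasDerivAt (fun t => nullCoord a b (f t) (g t) (h t))
      (nullCoordDiff a b (f s) (g s) (h s) f' g' h') s := by
  have key := (((hf.cosh.const_mul b).sub (hf.sinh.const_mul a)).div_const (b ^ 3)).add
    ((((hg.pow 2).add (hh.pow 2)).mul (hasDerivAt_warping (a := a) (b := b) hf)).div_const b)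
  refine key.congr_deriv ?_
  simp only [nullCoordDiff, Pi.add_apply, Pi.pow_apply]
  push_cast
  ring

theorem hasDerivAt_immersionCoord (a b : ℝ) (m : ℕ) {p : ℝ → ℕ → ℝ} {v : ℕ → ℝ} {s : ℝ}
    (hp : ∀ j, HasDerivAt (fun t => p t j) (v j) s) (k : ℕ) :
    HasDerivAt (fun t => immersionCoord a b m (p t) k) (immersionCoordDiff a b m (p s) v k) s := by
  have hP := hasDerivAt_coshProd hp
  have hw := hasDerivAt_warping (a := a) (b := b) (hp m)
  have hN := hasDerivAt_nullCoord (a := a) (b := b) (hp m) (hp (m + 1)) (hp (m + 2))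
  unfold immersionCoord immersionCoordDiff
  split_ifs
  · exact (hP m).mul ((hw.const_mul (b / 4)).add hN)
  · exact (hP m).mul ((hw.const_mul (b / 4)).sub hN)
  · exact (hP _).mul (hp _).sinh
  · exact (hP m).mul ((hp m).sinh.const_mul _)
  · exact (hP m).mul (hw.mul (hp _))
  · exact (hP m).mul (hw.mul (hp _))

theorem differentiable_immersionCoord {E : Type*} [NormedAddCommGroup E] [NormedSpace ℝ E]
    (a b : ℝ) (m : ℕ) {p : E → ℕ → ℝ} (hp : ∀ j, Differentiable ℝ fun x => p x j) (k : ℕ) :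
    Differentiable ℝ fun x => immersionCoord a b m (p x) k := by
  have hP : ∀ l, Differentiable ℝ fun x => coshProd (p x) l := fun l => by
    induction l with
    | zero => simp [coshProd]
    | succ l ih =>
      simp only [coshProd, Finset.prod_range_succ] at ih ⊢
      exact ih.mul (hp l).cosh
  have hw : Differentiable ℝ fun x => warping a b (p x m) :=
    ((hp m).sinh.const_mul a).add ((hp m).cosh.const_mul b)
  have hN : Differentiable ℝ fun x => nullCoord a b (p x m) (p x (m + 1)) (p x (m + 2)) := by
    unfold nullCoord
    have := (hp m).sinh
    have := (hp m).cosh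
    fun_prop
  unfold immersionCoord
  split_ifs
  · exact (hP m).mul ((hw.const_mul (b / 4)).add hN)
  · exact (hP m).mul ((hw.const_mul (b / 4)).sub hN)
  · exact (hP _).mul (hp _).sinh
  · exact (hP m).mul ((hp m).sinh.const_mul _)
  · exact (hP m).mul (hw.mul (hp _))
  · exact (hP m).mul (hw.mul (hp _))

theorem sum_sinh_mul_coshProd_diff (p v w : ℕ → ℝ) (m : ℕ) :
    ∑ k ∈ Finset.range m,
      (coshProdDiff p v k * Real.sinh (p k) + coshProd p k * (Real.cosh (p k) * v k)) *
        (coshProdDiff p w k * Real.sinh (p k) + coshProd p k * (Real.cosh (p k) * w k)) =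
      coshProdDiff p v m * coshProdDiff p w m +
        ∑ k ∈ Finset.range m, v k * w k * coshProd p k ^ 2 := by
  induction m with
  | zero => simp [coshProdDiff]
  | succ k ih =>
    rw [Finset.sum_range_succ, Finset.sum_range_succ, ih]
    simp only [coshProdDiff]
    linear_combination
      (v k * w k * coshProd p k ^ 2 - coshProdDiff p v k * coshProdDiff p w k) *
        Real.cosh_sq_sub_sinh_sq (p k)

theorem minkowski_immersionCoordDiff {a b : ℝ} (hab : a ^ 2 < b ^ 2) (m : ℕ) (p v w : ℕ → ℝ) :
    -(immersionCoordDiff a b m p v 0 * immersionCoordDiff a b m p w 0) +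
      ∑ k ∈ Finset.range (m + 4),
        immersionCoordDiff a b m p v (k + 1) * immersionCoordDiff a b m p w (k + 1) =
      ∑ k ∈ Finset.range (m + 3), v k * w k * metricCoeff a b m p k := by
  have hb : b ≠ 0 := by
    rintro rfl
    nlinarith [sq_nonneg a]
  have hσ : √(b ^ 2 - a ^ 2) ^ 2 = b ^ 2 - a ^ 2 := Real.sq_sqrt (by linarith)
  have hcs := Real.cosh_sq_sub_sinh_sq (p m)
  have hsum : ∑ k ∈ Finset.range m, immersionCoordDiff a b m p v (k + 1 + 1) *
      immersionCoordDiff a b m p w (k + 1 + 1) =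
      coshProdDiff p v m * coshProdDiff p w m +
        ∑ k ∈ Finset.range m, v k * w k * metricCoeff a b m p k := by
    have hG : ∑ k ∈ Finset.range m, v k * w k * metricCoeff a b m p k =
        ∑ k ∈ Finset.range m, v k * w k * coshProd p k ^ 2 := by
      refine Finset.sum_congr rfl fun k hk => ?_
      rw [metricCoeff, if_pos (Finset.mem_range.1 hk).le]
    rw [hG, ← sum_sinh_mul_coshProd_diff]
    refine Finset.sum_congr rfl fun k hk => ?_
    simp [immersionCoordDiff, show k + 1 ≤ m from Finset.mem_range.1 hk]
  rw [Finset.sum_range_succ, Finset.sum_range_succ, Finset.sum_range_succ, Finset.sum_range_succ',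
    hsum, Finset.sum_range_succ, Finset.sum_range_succ, Finset.sum_range_succ]
  generalize ∑ k ∈ Finset.range m, v k * w k * metricCoeff a b m p k = T
  simp [immersionCoordDiff, metricCoeff, nullCoordDiff, nullCoord, warping]
  generalize Real.cosh (p m) = C at *
  generalize Real.sinh (p m) = S at *
  generalize √(b ^ 2 - a ^ 2) = σ at *
  generalize coshProdDiff p v m = D at *
  generalize coshProdDiff p w m = E at *
  generalize coshProd p m = P at *
  generalize v m = v₀ at *
  generalize w m = w₀ at *
  linear_combination (norm := (field_simp; ring))
    (D * E * S ^ 2 / b ^ 2 + P * (D * w₀ + E * v₀) * S * C / b ^ 2 +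
      P ^ 2 * v₀ * w₀ * C ^ 2 / b ^ 2) *
      hσ + (P ^ 2 * v₀ * w₀ - D * E) * hcs

theorem differentiable_extendZero {n : ℕ} (j : ℕ) :
    Differentiable ℝ fun x : EuclideanSpace ℝ (Fin n) => extendZero x j := by
  unfold extendZero
  split_ifs
  · fun_prop
  · fun_prop

theorem extendZero_single {n : ℕ} (i : Fin n) (j : ℕ) :
    extendZero (EuclideanSpace.single i (1 : ℝ)) j = if j = i then 1 else 0 := by
  unfold extendZero
  split_ifs with h h' h'
  · simp [h']
  · simp [h', Fin.ext_iff]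
  · exact absurd (h' ▸ i.isLt) h
  · rfl

theorem extendZero_add_smul {n : ℕ} (x v : EuclideanSpace ℝ (Fin n)) (t : ℝ) (j : ℕ) :
    extendZero (x + t • v) j = extendZero x j + t * extendZero v j := by
  unfold extendZero
  split_ifs <;> simp

theorem prod_cosh_castLE {n k : ℕ} (h : k ≤ n) (x : EuclideanSpace ℝ (Fin n)) :
    ∏ j : Fin k, Real.cosh (x (Fin.castLE h j)) = coshProd (extendZero x) k := by
  rw [coshProd, ← Fin.prod_univ_eq_prod_range]
  refine Finset.prod_congr rfl fun j _ => ?_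
  simp [extendZero, Fin.castLE, j.isLt.trans_le h]

theorem pd_apply_eq_immersionCoordDiff {m : ℕ} {a b : ℝ}
    {L : EuclideanSpace ℝ (Fin (m + 3)) → EuclideanSpace ℝ (Fin (m + 3 + 2))}
    (hL : ∀ x k, L x k = immersionCoord a b m (extendZero x) k)
    (x : EuclideanSpace ℝ (Fin (m + 3))) (i : Fin (m + 3)) (k : Fin (m + 3 + 2)) :
    pd L x i k =
      immersionCoordDiff a b m (extendZero x) (fun j => if j = i then 1 else 0) k := by
  have hdiff : DifferentiableAt ℝ L x := by
    rw [differentiableAt_euclidean]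
    intro k
    simp only [hL]
    exact differentiable_immersionCoord a b m differentiable_extendZero k x
  have hline := hdiff.hasFDerivAt.hasLineDerivAt (EuclideanSpace.single i 1)
  have hcoord : HasDerivAt (fun t : ℝ => L (x + t • EuclideanSpace.single i 1) k)
      (pd L x i k) 0 :=
    (EuclideanSpace.proj (𝕜 := ℝ) k).hasFDerivAt.comp_hasDerivAt 0 hline
  refine hcoord.unique ?_
  simp only [hL]
  have key := hasDerivAt_immersionCoord a b m
    (p := fun t => extendZero (x + t • EuclideanSpace.single i (1 : ℝ)))
    (v := fun j => if j = i then 1 else 0) (s := 0) (fun j => by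
      simp only [extendZero_add_smul, extendZero_single]
      simpa using ((hasDerivAt_id (0 : ℝ)).mul_const (if j = (i : ℕ) then (1 : ℝ) else 0)).const_add
        (extendZero x j)) k
  simpa using key

theorem eta_pd_eq {m : ℕ} {a b : ℝ} (hab : a ^ 2 < b ^ 2)
    {L : EuclideanSpace ℝ (Fin (m + 3)) → EuclideanSpace ℝ (Fin (m + 3 + 2))}
    (hL : ∀ x k, L x k = immersionCoord a b m (extendZero x) k)
    (x : EuclideanSpace ℝ (Fin (m + 3))) (i j : Fin (m + 3)) :
    eta (pd L x i) (pd L x j) = if i = j then metricCoeff a b m (extendZero x) i else 0 := by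
  have h := minkowski_immersionCoordDiff hab m (extendZero x)
    (fun l => if l = i then 1 else 0) (fun l => if l = j then 1 else 0)
  rw [← Fin.sum_univ_eq_sum_range (fun k => immersionCoordDiff a b m (extendZero x)
    (fun l => if l = i then 1 else 0) (k + 1) * immersionCoordDiff a b m (extendZero x)
    (fun l => if l = j then 1 else 0) (k + 1))] at h
  simp only [eta, pd_apply_eq_immersionCoordDiff hL, Fin.val_succ, Fin.val_zero]
  rw [h]
  rcases eq_or_ne i j with rfl | hij
  · simp
  · simp [hij, Fin.val_ne_of_ne hij.symm]

theorem coord_eq_immersionCoord {m : ℕ} {a b : ℝ} (hb : b ≠ 0)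
    (x : EuclideanSpace ℝ (Fin (m + 3))) (k : Fin (m + 3 + 2)) :
    (let S := Real.sinh (x ⟨m + 3 - 3, by omega⟩);
      let C := Real.cosh (x ⟨m + 3 - 3, by omega⟩);
      let P := ∏ j : Fin (m + 3 - 3), Real.cosh (x (Fin.castLE (by omega) j));
      let ρ := x ⟨m + 3 - 2, by omega⟩ ^ 2 + x ⟨m + 3 - 1, by omega⟩ ^ 2;
      if (k : ℕ) = 0 then
        (a * (b ^ 4 - 4 + 4 * b ^ 2 * ρ) * S + b * (b ^ 4 + 4 + 4 * b ^ 2 * ρ) * C) *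
          P / (4 * b ^ 3)
      else if (k : ℕ) = 1 then
        (a * (b ^ 4 + 4 - 4 * b ^ 2 * ρ) * S + b * (b ^ 4 - 4 - 4 * b ^ 2 * ρ) * C) *
          P / (4 * b ^ 3)
      else if h : (k : ℕ) ≤ m + 3 - 2 then
        Real.sinh (x ⟨(k : ℕ) - 2, by omega⟩) *
          ∏ j : Fin ((k : ℕ) - 2), Real.cosh (x (Fin.castLE (by omega) j))
      else if (k : ℕ) = m + 3 - 1 then
        Real.sqrt (b ^ 2 - a ^ 2) / b * S * P
      else if (k : ℕ) = m + 3 then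
        (a * S + b * C) * x ⟨m + 3 - 2, by omega⟩ * P
      else
        (a * S + b * C) * x ⟨m + 3 - 1, by omega⟩ * P) =
      immersionCoord a b m (extendZero x) k := by
  have h0 : extendZero x m = x ⟨m + 3 - 3, by omega⟩ := by simp [extendZero]
  have h1 : extendZero x (m + 1) = x ⟨m + 3 - 2, by omega⟩ := by simp [extendZero]
  have h2 : extendZero x (m + 2) = x ⟨m + 3 - 1, by omega⟩ := by simp [extendZero]
  simp only [prod_cosh_castLE, immersionCoord, h0, h1, h2, nullCoord, warping]
  split_ifs
  · simp only [Nat.add_sub_cancel]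
    field_simp
    ring
  · simp only [Nat.add_sub_cancel]
    field_simp
    ring
  · rw [extendZero, dif_pos (by omega), mul_comm]
  all_goals first | omega | (simp only [Nat.add_sub_cancel]; ring)

theorem stmt10 (n : ℕ) (hn : 4 ≤ n) (a b : ℝ) (hab : a ^ 2 < b ^ 2)
    (L : EuclideanSpace ℝ (Fin n) → EuclideanSpace ℝ (Fin (n + 2)))
    (hL : ∀ (x : EuclideanSpace ℝ (Fin n)) (k : Fin (n + 2)),
      L x k =
        (let S := Real.sinh (x ⟨n - 3, by omega⟩);
         let C := Real.cosh (x ⟨n - 3, by omega⟩);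
         let P := ∏ j : Fin (n - 3), Real.cosh (x (Fin.castLE (by omega) j));
         let ρ := x ⟨n - 2, by omega⟩ ^ 2 + x ⟨n - 1, by omega⟩ ^ 2;
         if (k : ℕ) = 0 then
           (a * (b ^ 4 - 4 + 4 * b ^ 2 * ρ) * S + b * (b ^ 4 + 4 + 4 * b ^ 2 * ρ) * C) *
             P / (4 * b ^ 3)
         else if (k : ℕ) = 1 then
           (a * (b ^ 4 + 4 - 4 * b ^ 2 * ρ) * S + b * (b ^ 4 - 4 - 4 * b ^ 2 * ρ) * C) *
             P / (4 * b ^ 3)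
         else if h : (k : ℕ) ≤ n - 2 then
           Real.sinh (x ⟨(k : ℕ) - 2, by omega⟩) *
             ∏ j : Fin ((k : ℕ) - 2), Real.cosh (x (Fin.castLE (by omega) j))
         else if (k : ℕ) = n - 1 then
           Real.sqrt (b ^ 2 - a ^ 2) / b * S * P
         else if (k : ℕ) = n then
           (a * S + b * C) * x ⟨n - 2, by omega⟩ * P
         else
           (a * S + b * C) * x ⟨n - 1, by omega⟩ * P)) :
    ∀ x : EuclideanSpace ℝ (Fin n),
      (∀ i j : Fin n, i ≠ j → eta (pd L x i) (pd L x j) = 0) ∧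
      eta (pd L x ⟨0, by omega⟩) (pd L x ⟨0, by omega⟩) = 1 ∧
      (∀ i : Fin n, 1 ≤ (i : ℕ) → (i : ℕ) ≤ n - 3 →
        eta (pd L x i) (pd L x i) =
          ∏ j : Fin (i : ℕ), Real.cosh (x (Fin.castLE i.isLt.le j)) ^ 2) ∧
      eta (pd L x ⟨n - 2, by omega⟩) (pd L x ⟨n - 2, by omega⟩) =
        (a * Real.sinh (x ⟨n - 3, by omega⟩) + b * Real.cosh (x ⟨n - 3, by omega⟩)) ^ 2 *
          (∏ j : Fin (n - 3), Real.cosh (x (Fin.castLE (by omega) j))) ^ 2 ∧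
      eta (pd L x ⟨n - 1, by omega⟩) (pd L x ⟨n - 1, by omega⟩) =
        (a * Real.sinh (x ⟨n - 3, by omega⟩) + b * Real.cosh (x ⟨n - 3, by omega⟩)) ^ 2 *
          (∏ j : Fin (n - 3), Real.cosh (x (Fin.castLE (by omega) j))) ^ 2 := by
  obtain ⟨m, rfl⟩ : ∃ m, n = m + 3 := ⟨n - 3, by omega⟩
  have hb : b ≠ 0 := by
    rintro rfl
    nlinarith [sq_nonneg a]
  have hL' : ∀ x k, L x k = immersionCoord a b m (extendZero x) k := fun x k =>
    (hL x k).trans (coord_eq_immersionCoord hb x k)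
  intro x
  have hm : extendZero x m = x ⟨m + 3 - 3, by omega⟩ := by simp [extendZero]
  simp only [eta_pd_eq hab hL', prod_cosh_castLE, Finset.prod_pow, ← hm]
  refine ⟨fun i j hij => if_neg hij, ?_, fun i _ hi => ?_, ?_, ?_⟩
  · simp [metricCoeff, coshProd]
  · rw [if_pos trivial, metricCoeff, if_pos (by omega)]
  · simp [metricCoeff, warping]
  · simp [metricCoeff, warping]
end

section
/- Let n ≥ 4 be an integer and a, b real numbers with 1 + a² < b². Let L : ℝⁿ → ℝ^{n+2} be the map with coordinates (writing S = sinh x_{n−2}, C = cosh x_{n−2}, P = ∏_{j=1}^{n−3} cosh x_j): u₁ = (aS+bC) cosh x_{n−1} cosh x_n · P; u₂ = (aS+bC) cosh x_{n−1} sinh x_n · P; u₃ = (aS+bC) sinh x_{n−1} · P; u_{k+3} = sinh(x_k)∏_{j=1}^{k−1} cosh x_j for 1 ≤ k ≤ n−3; u_{n+1} = (√(b²−a²−1)/√(1+a²)) C P; u_{n+2} = (abC + (1+a²)S)·P/√(1+a²). Then η(L(x), L(x)) = −1 for every x ∈ ℝⁿ; i.e., L maps ℝⁿ into the quadric {u ∈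 ℝ^{n+2} : η(u,u) = −1}. -/
open Real

theorem sum_sq_sinh_mul_prod_cosh (y : ℕ → ℝ) (m : ℕ) :
    ∑ i : Fin m, (Real.sinh (y i) * ∏ j : Fin (i : ℕ), Real.cosh (y j)) ^ 2 =
      (∏ j : Fin m, Real.cosh (y j)) ^ 2 - 1 := by
  induction m with
  | zero => simp
  | succ m ih =>
    rw [Fin.sum_univ_castSucc, Fin.prod_univ_castSucc]
    simp only [Fin.val_castSucc, Fin.val_last]
    rw [ih, mul_pow, mul_pow, Real.cosh_sq (y m)]
    ring

theorem stmt11 (n : ℕ) (hn : 4 ≤ n) (a b : ℝ) (hab : 1 + a ^ 2 < b ^ 2)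
    (L : EuclideanSpace ℝ (Fin n) → EuclideanSpace ℝ (Fin (n + 2)))
    (hL : ∀ (x : EuclideanSpace ℝ (Fin n)) (k : Fin (n + 2)),
      L x k =
        (let S := Real.sinh (x ⟨n - 3, by omega⟩);
         let C := Real.cosh (x ⟨n - 3, by omega⟩);
         let P := ∏ j : Fin (n - 3), Real.cosh (x (Fin.castLE (by omega) j));
         if (k : ℕ) = 0 then
           (a * S + b * C) * Real.cosh (x ⟨n - 2, by omega⟩) *
             Real.cosh (x ⟨n - 1, by omega⟩) * P
         else if (k : ℕ) = 1 then
           (a * S + b * C) * Real.cosh (x ⟨n - 2, by omega⟩) *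
             Real.sinh (x ⟨n - 1, by omega⟩) * P
         else if (k : ℕ) = 2 then
           (a * S + b * C) * Real.sinh (x ⟨n - 2, by omega⟩) * P
         else if h : (k : ℕ) ≤ n - 1 then
           Real.sinh (x ⟨(k : ℕ) - 3, by omega⟩) *
             ∏ j : Fin ((k : ℕ) - 3), Real.cosh (x (Fin.castLE (by omega) j))
         else if (k : ℕ) = n then
           Real.sqrt (b ^ 2 - a ^ 2 - 1) / Real.sqrt (1 + a ^ 2) * C * P
         else
           (a * b * C + (1 + a ^ 2) * S) * P / Real.sqrt (1 + a ^ 2))) :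
    ∀ x : EuclideanSpace ℝ (Fin n), eta (L x) (L x) = -1 := by
  intro x
  obtain ⟨m, rfl⟩ : ∃ m, n = m + 3 := ⟨n - 3, by omega⟩
  let y : ℕ → ℝ := fun i => if h : i < m + 3 then x ⟨i, h⟩ else 0
  have hy : ∀ (i : ℕ) (h : i < m + 3), x ⟨i, h⟩ = y i := fun i h => by simp [y, h]
  have hx := hL x
  simp only [hy, Fin.val_castLE] at hx
  clear_value y
  rw [Fin.prod_univ_eq_prod_range (fun j => Real.cosh (y j)) (m + 3 - 3)] at hx
  simp only [show m + 3 - 3 = m by omega, show m + 3 - 2 = m + 1 by omega,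
    show m + 3 - 1 = m + 2 by omega] at hx
  have key := sum_sq_sinh_mul_prod_cosh y m
  rw [Fin.prod_univ_eq_prod_range (fun j => Real.cosh (y j)) m] at key
  set P := ∏ j ∈ Finset.range m, Real.cosh (y j)
  have hmid : ∀ i : Fin m, L x (Fin.castSucc (Fin.castSucc i)).succ.succ.succ =
      Real.sinh (y i) * ∏ j : Fin (i : ℕ), Real.cosh (y j) := by
    intro i
    rw [hx]
    simp only [Fin.val_succ, Fin.val_castSucc]
    rw [if_neg (by omega), if_neg (by omega), if_neg (by omega), dif_pos (by omega)]
    rfl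
  have h0 : L x 0 = (a * Real.sinh (y m) + b * Real.cosh (y m)) * Real.cosh (y (m + 1)) *
      Real.cosh (y (m + 2)) * P := by
    rw [hx]; simp
  have h1 : L x (Fin.succ 0) = (a * Real.sinh (y m) + b * Real.cosh (y m)) *
      Real.cosh (y (m + 1)) * Real.sinh (y (m + 2)) * P := by
    rw [hx]; simp
  have h2 : L x (Fin.succ (Fin.succ 0)) = (a * Real.sinh (y m) + b * Real.cosh (y m)) *
      Real.sinh (y (m + 1)) * P := by
    rw [hx]; simp only [Fin.val_succ, Fin.val_zero]; simp
  have h3 : L x (Fin.castSucc (Fin.last m)).succ.succ.succ =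
      Real.sqrt (b ^ 2 - a ^ 2 - 1) / Real.sqrt (1 + a ^ 2) * Real.cosh (y m) * P := by
    rw [hx]
    simp
  have h4 : L x (Fin.last (m + 1)).succ.succ.succ =
      (a * b * Real.cosh (y m) + (1 + a ^ 2) * Real.sinh (y m)) * P / Real.sqrt (1 + a ^ 2) := by
    rw [hx]
    simp
  have hs1 : Real.sqrt (b ^ 2 - a ^ 2 - 1) ^ 2 = b ^ 2 - a ^ 2 - 1 :=
    Real.sq_sqrt (by linarith)
  have hpos : 0 < 1 + a ^ 2 := by positivity
  have hs2 : Real.sqrt (1 + a ^ 2) ^ 2 = 1 + a ^ 2 := Real.sq_sqrt hpos.le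
  unfold eta
  rw [Fin.sum_univ_succ, Fin.sum_univ_succ, Fin.sum_univ_castSucc, Fin.sum_univ_castSucc]
  rw [h0, h1, h2, h3, h4]
  simp only [hmid, ← pow_two]
  rw [key]
  simp only [mul_pow, div_pow, hs1, hs2]
  rw [Real.cosh_sq (y (m + 2)), Real.cosh_sq (y (m + 1))]
  have hc := Real.cosh_sq (y m)
  field_simp
  linear_combination (-P ^ 2 * (1 + a ^ 2)) * hc
end

section
/- Let n ≥ 4 be an integer and a, b real numbers with a² < 1 + b², let U = {x ∈ ℝⁿ : a sinh x_{n−2} + b cosh x_{n−2} > 0}, and let L : ℝⁿ → ℝ^{n+2} be immersion (A) (with S = sinh x_{n−2}, C = cosh x_{n−2}, P = ∏_{j=1}^{n−3} cosh x_j: u₁ = (abS+(1+b²)C)P/√(1+b²); u_{k+1} = sinh(x_k)∏_{j=1}^{k−1} cosh x_j for 1 ≤ k ≤ n−3; u_{n−1} = (√(1−a²+b²)/√(1+b²))SP; (u_n,u_{n+1},u_{n+2}) = (aS+bC)P·(cos x_{n−1} cos x_n, cos x_{n−1} sin x_n, sin x_{n−1})). Then there exists a smooth map ξ : U → ℝ^{n+2}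 such that for every x ∈ U: η(ξ(x), ξ(x)) = 1; η(ξ(x), L(x)) = 0; η(ξ(x), ∂L/∂x_i(x)) = 0 for all 1 ≤ i ≤ n; η(∂²L/∂x_i∂x_j(x), ξ(x)) = 0 for every pair (i,j) other than (n−1,n−1) and (n,n); η(∂²L/∂x_{n−1}²(x), ξ(x)) = √(1−a²+b²)(aS+bC)P; and η(∂²L/∂x_n²(x), ξ(x)) = √(1−a²+b²)(aS+bC)P cos²x_{n−1}. In particular the second fundamental form of the hypersurface in direction ξ equals λ times the induced metric on the last two coordinate directions and vanishes otherwise, where λ = √(1−a²+b²)/((aS+bC)P) is nowhere zero, so the hypersurface has no minimal points in hyperbolic space. -/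
open Real

/-- Second partial derivative of `L` at `x` in the directions of the `i`-th and `j`-th
standard basis vectors. -/
noncomputable def pd2 {n : ℕ} {F : Type*} [NormedAddCommGroup F] [NormedSpace ℝ F]
    (L : EuclideanSpace ℝ (Fin n) → F) (x : EuclideanSpace ℝ (Fin n)) (i j : Fin n) : F :=
  pd (fun y => pd L y i) x j

open scoped ContDiff

/-- If `u` is supported on the index `0` and the last four indices, so is the sum in `eta u v`. -/
lemma eta_eq_of_support {n : ℕ} (hn : 4 ≤ n) (u v : EuclideanSpace ℝ (Fin (n + 2)))
    (hu : ∀ k : Fin (n + 2), (k : ℕ) ≠ 0 → (k : ℕ) ≤ n - 3 → u k = 0) :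
    eta u v = -(u 0 * v 0) + u ⟨n - 2, by omega⟩ * v ⟨n - 2, by omega⟩
      + u ⟨n - 1, by omega⟩ * v ⟨n - 1, by omega⟩
      + u ⟨n, by omega⟩ * v ⟨n, by omega⟩ + u ⟨n + 1, by omega⟩ * v ⟨n + 1, by omega⟩ := by
  obtain ⟨m, rfl⟩ : ∃ m, n = m + 3 := ⟨n - 3, by omega⟩
  have hz : ∑ j : Fin m,
      u j.castSucc.castSucc.castSucc.castSucc.succ *
        v j.castSucc.castSucc.castSucc.castSucc.succ = 0 := by
    refine Finset.sum_eq_zero fun j _ => ?_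
    rw [hu _ (by simp) (by simp only [Fin.val_succ, Fin.val_castSucc]; omega), zero_mul]
  unfold eta
  rw [Fin.sum_univ_castSucc, Fin.sum_univ_castSucc, Fin.sum_univ_castSucc,
    Fin.sum_univ_castSucc, hz, zero_add, ← add_assoc, ← add_assoc, ← add_assoc]
  rfl

lemma eta_comm {N : ℕ} (u v : EuclideanSpace ℝ (Fin (N + 1))) : eta u v = eta v u := by
  simp only [eta, mul_comm]

/-- The linear functional `eta v`. -/
noncomputable def etaCLM {N : ℕ} (v : EuclideanSpace ℝ (Fin (N + 1))) :
    EuclideanSpace ℝ (Fin (N + 1)) →L[ℝ] ℝ :=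
  -(v 0 • EuclideanSpace.proj 0) + ∑ j : Fin N, v j.succ • EuclideanSpace.proj j.succ

lemma etaCLM_apply {N : ℕ} (v u : EuclideanSpace ℝ (Fin (N + 1))) :
    etaCLM v u = eta v u := by
  simp [etaCLM, eta]

section PartialDerivatives

variable {n : ℕ} {F G : Type*} [NormedAddCommGroup F] [NormedSpace ℝ F]
  [NormedAddCommGroup G] [NormedSpace ℝ G]

lemma ContDiff.pd {f : EuclideanSpace ℝ (Fin n) → F} (hf : ContDiff ℝ ∞ f) (i : Fin n) :
    ContDiff ℝ ∞ (fun y => pd f y i) :=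
  (hf.fderiv_right (by simp)).clm_apply contDiff_const

lemma pd_clm_comp (l : F →L[ℝ] G) {f : EuclideanSpace ℝ (Fin n) → F} {x}
    (hf : DifferentiableAt ℝ f x) (i : Fin n) : pd (fun y => l (f y)) x i = l (pd f x i) := by
  have h := (l.hasFDerivAt.comp x hf.hasFDerivAt).fderiv
  simp only [Function.comp_def] at h
  simp [pd, h]

lemma pd2_clm_comp (l : F →L[ℝ] G) {f : EuclideanSpace ℝ (Fin n) → F}
    (hf : ContDiff ℝ ∞ f) (x) (i j : Fin n) :
    pd2 (fun y => l (f y)) x i j = l (pd2 f x i j) := by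
  unfold pd2
  rw [← pd_clm_comp l ((hf.pd i).differentiable (by simp) x)]
  congr 1
  funext y
  exact pd_clm_comp l (hf.differentiable (by simp) y) i

lemma pd_mul {g h : EuclideanSpace ℝ (Fin n) → ℝ} {x} (hg : DifferentiableAt ℝ g x)
    (hh : DifferentiableAt ℝ h x) (i : Fin n) :
    pd (fun y => g y * h y) x i = g x * pd h x i + h x * pd g x i := by
  simp [pd, fderiv_fun_mul hg hh]

lemma pd_add {g h : EuclideanSpace ℝ (Fin n) → ℝ} {x} (hg : DifferentiableAt ℝ g x)
    (hh : DifferentiableAt ℝ h x) (i : Fin n) :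
    pd (fun y => g y + h y) x i = pd g x i + pd h x i := by
  simp [pd, fderiv_fun_add hg hh]

/-- At a critical zero of `h`, the Hessian of `g * h` is `g` times the Hessian of `h`. -/
lemma pd2_mul_of_critical {g h : EuclideanSpace ℝ (Fin n) → ℝ} (hg : ContDiff ℝ ∞ g)
    (hh : ContDiff ℝ ∞ h) {x} (h0 : h x = 0) (h1 : ∀ i, pd h x i = 0) (i j : Fin n) :
    pd2 (fun y => g y * h y) x i j = g x * pd2 h x i j := by
  have hgd := hg.differentiable (by simp)
  have hhd := hh.differentiable (by simp)
  have hgi := (hg.pd i).differentiable (by simp)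
  have hhi := (hh.pd i).differentiable (by simp)
  have e : (fun y => pd (fun y => g y * h y) y i) =
      fun y => g y * pd h y i + h y * pd g y i :=
    funext fun y => pd_mul (hgd y) (hhd y) i
  unfold pd2
  rw [e, pd_add ((hgd x).fun_mul (hhi x)) ((hhd x).fun_mul (hgi x)), pd_mul (hgd x) (hhi x),
    pd_mul (hhd x) (hgi x)]
  simp [h0, h1]

end PartialDerivatives

/-- `1 - ⟨ω(s, t), ω(y k, y l)⟩`, where `ω` parametrizes the unit sphere by latitude and
longitude. -/
noncomputable def sphereDefect {n : ℕ} (k l : Fin n) (s t : ℝ)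
    (y : EuclideanSpace ℝ (Fin n)) : ℝ :=
  1 - cos s * cos (y k) * (cos t * cos (y l) + sin t * sin (y l)) - sin s * sin (y k)

section SphereDefect

variable {n : ℕ} (k l : Fin n)

lemma contDiff_sphereDefect (s t : ℝ) : ContDiff ℝ ∞ (sphereDefect k l s t) := by
  unfold sphereDefect
  fun_prop

lemma sphereDefect_self (x : EuclideanSpace ℝ (Fin n)) :
    sphereDefect k l (x k) (x l) x = 0 := by
  unfold sphereDefect
  linear_combination (-cos (x k) ^ 2) * sin_sq_add_cos_sq (x l) - sin_sq_add_cos_sq (x k)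

lemma pd_sphereDefect (s t : ℝ) (y : EuclideanSpace ℝ (Fin n)) (i : Fin n) :
    pd (sphereDefect k l s t) y i =
      (if k = i then 1 else 0) * (cos s * sin (y k) * (cos t * cos (y l) + sin t * sin (y l))
        - sin s * cos (y k)) +
      (if l = i then 1 else 0) * (cos s * cos (y k) * (cos t * sin (y l) - sin t * cos (y l))) := by
  have hp (k : Fin n) : HasFDerivAt (fun y : EuclideanSpace ℝ (Fin n) => y k)
      (EuclideanSpace.proj k : EuclideanSpace ℝ (Fin n) →L[ℝ] ℝ) y :=
    (EuclideanSpace.proj k : EuclideanSpace ℝ (Fin n) →L[ℝ] ℝ).hasFDerivAt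
  have h := ((((hp k).cos.const_mul (cos s)).mul
    (((hp l).cos.const_mul (cos t)).add ((hp l).sin.const_mul (sin t)))).const_sub 1).sub
    ((hp k).sin.const_mul (sin s))
  have h' : HasFDerivAt (sphereDefect k l s t) _ y := h
  rw [pd, h'.fderiv]
  simp
  split_ifs <;> ring

lemma pd_sphereDefect_self (x : EuclideanSpace ℝ (Fin n)) (i : Fin n) :
    pd (sphereDefect k l (x k) (x l)) x i = 0 := by
  rw [pd_sphereDefect]
  linear_combination (if k = i then 1 else 0) * (cos (x k) * sin (x k)) *
    sin_sq_add_cos_sq (x l)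

lemma pd2_sphereDefect_self (x : EuclideanSpace ℝ (Fin n)) (i j : Fin n) :
    pd2 (sphereDefect k l (x k) (x l)) x i j =
      (if k = i then 1 else 0) * (if k = j then 1 else 0) +
      (if l = i then 1 else 0) * (if l = j then 1 else 0) * cos (x k) ^ 2 := by
  have hp (k : Fin n) : HasFDerivAt (fun y : EuclideanSpace ℝ (Fin n) => y k)
      (EuclideanSpace.proj k : EuclideanSpace ℝ (Fin n) →L[ℝ] ℝ) x :=
    (EuclideanSpace.proj k : EuclideanSpace ℝ (Fin n) →L[ℝ] ℝ).hasFDerivAt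
  have h := (((((hp k).sin.const_mul (cos (x k))).mul
    (((hp l).cos.const_mul (cos (x l))).add ((hp l).sin.const_mul (sin (x l))))).sub
    ((hp k).cos.const_mul (sin (x k)))).const_mul (if k = i then (1 : ℝ) else 0)).add
    ((((hp k).cos.const_mul (cos (x k))).mul
    (((hp l).sin.const_mul (cos (x l))).sub ((hp l).cos.const_mul (sin (x l))))).const_mul
      (if l = i then (1 : ℝ) else 0))
  have h' : HasFDerivAt (fun y => pd (sphereDefect k l (x k) (x l)) y i) _ x :=
    h.congr_of_eventuallyEq (Filter.Eventually.of_forall fun y => pd_sphereDefect k l _ _ y i)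
  rw [pd2, pd, h'.fderiv]
  have e1 := sin_sq_add_cos_sq (x l)
  have e2 := sin_sq_add_cos_sq (x k)
  simp only [add_apply, sub_apply, smul_apply, PiLp.proj_apply, PiLp.single_apply,
    smul_eq_mul, Pi.add_apply, Pi.sub_apply]
  generalize (if k = i then (1 : ℝ) else 0) = p
  generalize (if l = i then (1 : ℝ) else 0) = p'
  generalize (if k = j then (1 : ℝ) else 0) = r
  generalize (if l = j then (1 : ℝ) else 0) = r'
  linear_combination (p * r * cos (x k) ^ 2 + p' * r' * cos (x k) ^ 2) * e1 + p * r * e2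

end SphereDefect

/-- The unit normal of the immersion, where `x k` and `x l` are the latitude and longitude on the
sphere; it is constant except for its spherical part. -/
noncomputable def unitNormal {n : ℕ} (k l : Fin n) (a b : ℝ) (x : EuclideanSpace ℝ (Fin n)) :
    EuclideanSpace ℝ (Fin (n + 2)) :=
  WithLp.toLp 2 fun m =>
    if (m : ℕ) = 0 then -(√(1 - a ^ 2 + b ^ 2) * b / √(1 + b ^ 2))
    else if (m : ℕ) ≤ n - 3 then 0
    else if (m : ℕ) = n - 2 then a / √(1 + b ^ 2)
    else if (m : ℕ) = n - 1 then
      -(√(1 - a ^ 2 + b ^ 2) * (cos (x k) * cos (x l)))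
    else if (m : ℕ) = n then
      -(√(1 - a ^ 2 + b ^ 2) * (cos (x k) * sin (x l)))
    else -(√(1 - a ^ 2 + b ^ 2) * sin (x k))

lemma contDiff_unitNormal {n : ℕ} (k l : Fin n) (a b : ℝ) :
    ContDiff ℝ ∞ (unitNormal k l a b) := by
  rw [contDiff_euclidean]
  intro m
  simp only [unitNormal]
  split_ifs <;> fun_prop

lemma eta_unitNormal {n : ℕ} (hn : 4 ≤ n) (k l : Fin n) (a b : ℝ) (x : EuclideanSpace ℝ (Fin n))
    (v : EuclideanSpace ℝ (Fin (n + 2))) :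
    eta (unitNormal k l a b x) v =
      √(1 - a ^ 2 + b ^ 2) * b / √(1 + b ^ 2) * v 0 + a / √(1 + b ^ 2) * v ⟨n - 2, by omega⟩
      - √(1 - a ^ 2 + b ^ 2) *
        (cos (x k) * cos (x l) * v ⟨n - 1, by omega⟩
        + cos (x k) * sin (x l) * v ⟨n, by omega⟩
        + sin (x k) * v ⟨n + 1, by omega⟩) := by
  rw [eta_eq_of_support hn _ _ fun m h0 h1 => by simp only [unitNormal, if_neg h0, if_pos h1]]
  simp (disch := omega) only [unitNormal, Fin.val_zero, if_true, if_neg]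
  ring

lemma eta_unitNormal_self {n : ℕ} (hn : 4 ≤ n) (k l : Fin n) {a b : ℝ} (hab : a ^ 2 < 1 + b ^ 2)
    (x : EuclideanSpace ℝ (Fin n)) :
    eta (unitNormal k l a b x) (unitNormal k l a b x) = 1 := by
  rw [eta_unitNormal hn]
  simp (disch := omega) only [unitNormal, Fin.val_zero, if_true, if_neg]
  have hr : (√(1 + b ^ 2)) ^ 2 = 1 + b ^ 2 := sq_sqrt (by positivity)
  have hr0 : √(1 + b ^ 2) ≠ 0 := (sqrt_pos.2 (by positivity)).ne'
  have hq : (√(1 - a ^ 2 + b ^ 2)) ^ 2 = 1 - a ^ 2 + b ^ 2 := sq_sqrt (by linarith)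
  have e1 := sin_sq_add_cos_sq (x l)
  have e2 := sin_sq_add_cos_sq (x k)
  generalize √(1 + b ^ 2) = r at *
  generalize √(1 - a ^ 2 + b ^ 2) = q at *
  generalize cos (x k) = c at *
  generalize sin (x k) = s at *
  generalize cos (x l) = c' at *
  generalize sin (x l) = s' at *
  field_simp
  linear_combination r ^ 2 * q ^ 2 * c ^ 2 * e1 + r ^ 2 * q ^ 2 * e2 + (q ^ 2 - 1) * hr + hq

theorem stmt14 (n : ℕ) (hn : 4 ≤ n) (a b : ℝ) (hab : a ^ 2 < 1 + b ^ 2)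
    (U : Set (EuclideanSpace ℝ (Fin n)))
    (hU : U = {x | 0 < a * Real.sinh (x ⟨n - 3, by omega⟩) +
      b * Real.cosh (x ⟨n - 3, by omega⟩)})
    (L : EuclideanSpace ℝ (Fin n) → EuclideanSpace ℝ (Fin (n + 2)))
    (hL : ∀ (x : EuclideanSpace ℝ (Fin n)) (k : Fin (n + 2)),
      L x k =
        (let S := Real.sinh (x ⟨n - 3, by omega⟩);
         let C := Real.cosh (x ⟨n - 3, by omega⟩);
         let P := ∏ j : Fin (n - 3), Real.cosh (x (Fin.castLE (by omega) j));
         if (k : ℕ) = 0 then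
           (a * b * S + (1 + b ^ 2) * C) * P / Real.sqrt (1 + b ^ 2)
         else if h : (k : ℕ) ≤ n - 3 then
           Real.sinh (x ⟨(k : ℕ) - 1, by omega⟩) *
             ∏ j : Fin ((k : ℕ) - 1), Real.cosh (x (Fin.castLE (by omega) j))
         else if (k : ℕ) = n - 2 then
           Real.sqrt (1 - a ^ 2 + b ^ 2) / Real.sqrt (1 + b ^ 2) * S * P
         else if (k : ℕ) = n - 1 then
           (a * S + b * C) * Real.cos (x ⟨n - 2, by omega⟩) *
             Real.cos (x ⟨n - 1, by omega⟩) * P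
         else if (k : ℕ) = n then
           (a * S + b * C) * Real.cos (x ⟨n - 2, by omega⟩) *
             Real.sin (x ⟨n - 1, by omega⟩) * P
         else
           (a * S + b * C) * Real.sin (x ⟨n - 2, by omega⟩) * P)) :
    ∃ ξ : EuclideanSpace ℝ (Fin n) → EuclideanSpace ℝ (Fin (n + 2)),
      ContDiffOn ℝ (⊤ : ℕ∞) ξ U ∧
      ∀ x ∈ U,
        eta (ξ x) (ξ x) = 1 ∧
        eta (ξ x) (L x) = 0 ∧
        (∀ i : Fin n, eta (ξ x) (pd L x i) = 0) ∧
        (∀ i j : Fin n, ¬(i = j ∧ ((i : ℕ) = n - 2 ∨ (i : ℕ) = n - 1)) →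
          eta (pd2 L x i j) (ξ x) = 0) ∧
        eta (pd2 L x ⟨n - 2, by omega⟩ ⟨n - 2, by omega⟩) (ξ x) =
          Real.sqrt (1 - a ^ 2 + b ^ 2) *
            (a * Real.sinh (x ⟨n - 3, by omega⟩) + b * Real.cosh (x ⟨n - 3, by omega⟩)) *
            (∏ j : Fin (n - 3), Real.cosh (x (Fin.castLE (by omega) j))) ∧
        eta (pd2 L x ⟨n - 1, by omega⟩ ⟨n - 1, by omega⟩) (ξ x) =
          Real.sqrt (1 - a ^ 2 + b ^ 2) *
            (a * Real.sinh (x ⟨n - 3, by omega⟩) + b * Real.cosh (x ⟨n - 3, by omega⟩)) *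
            (∏ j : Fin (n - 3), Real.cosh (x (Fin.castLE (by omega) j))) *
            Real.cos (x ⟨n - 2, by omega⟩) ^ 2 ∧
        Real.sqrt (1 - a ^ 2 + b ^ 2) /
            ((a * Real.sinh (x ⟨n - 3, by omega⟩) + b * Real.cosh (x ⟨n - 3, by omega⟩)) *
              ∏ j : Fin (n - 3), Real.cosh (x (Fin.castLE (by omega) j))) ≠ 0 := by
  have hLsmooth : ContDiff ℝ ∞ L := by
    rw [contDiff_euclidean]
    intro k
    simp only [hL]
    have hP (m : ℕ) (hm : m ≤ n) : ContDiff ℝ ∞ (fun x : EuclideanSpace ℝ (Fin n) =>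
        ∏ j : Fin m, Real.cosh (x (Fin.castLE hm j))) :=
      contDiff_prod fun j _ => by fun_prop
    have hP1 := hP (n - 3) (by omega)
    split_ifs with _ h
    · fun_prop
    · have hP2 := hP ((k : ℕ) - 1) (by omega)
      fun_prop
    all_goals fun_prop
  set q := √(1 - a ^ 2 + b ^ 2) with hqdef
  have hqpos : 0 < q := sqrt_pos.2 (by linarith)
  let G : EuclideanSpace ℝ (Fin n) → ℝ := fun y =>
    q * (a * Real.sinh (y ⟨n - 3, by omega⟩) + b * Real.cosh (y ⟨n - 3, by omega⟩)) *
      ∏ j : Fin (n - 3), Real.cosh (y (Fin.castLE (by omega) j))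
  have hG : ContDiff ℝ ∞ G := by
    have hP : ContDiff ℝ ∞ (fun x : EuclideanSpace ℝ (Fin n) =>
        ∏ j : Fin (n - 3), Real.cosh (x (Fin.castLE (by omega) j))) :=
      contDiff_prod fun j _ => by fun_prop
    fun_prop
  let k : Fin n := ⟨n - 2, by omega⟩
  let l : Fin n := ⟨n - 1, by omega⟩
  have hkl : k ≠ l := by simp only [k, l, ne_eq, Fin.mk.injEq]; omega
  have key (x y) : etaCLM (unitNormal k l a b x) (L y) =
      G y * sphereDefect k l (x k) (x l) y := by
    rw [etaCLM_apply, eta_unitNormal hn]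
    simp (disch := omega) only [hL, Fin.val_zero, if_true, if_neg, dif_neg, sphereDefect, G, k, l,
      ← hqdef]
    have hr : (√(1 + b ^ 2)) ^ 2 = 1 + b ^ 2 := sq_sqrt (by positivity)
    have hr0 : √(1 + b ^ 2) ≠ 0 := (sqrt_pos.2 (by positivity)).ne'
    generalize √(1 + b ^ 2) = r at hr hr0 ⊢
    generalize (∏ j : Fin (n - 3), Real.cosh (y (Fin.castLE _ j))) = P
    field_simp
    linear_combination (-P * (a * Real.sinh (y ⟨n - 3, by omega⟩) +
      b * Real.cosh (y ⟨n - 3, by omega⟩))) * hr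
  have hd1 (x i) : eta (unitNormal k l a b x) (pd L x i) = 0 := by
    rw [← etaCLM_apply, ← pd_clm_comp _ (hLsmooth.differentiable (by simp) x)]
    simp only [key]
    rw [pd_mul (hG.differentiable (by simp) x)
      ((contDiff_sphereDefect k l _ _).differentiable (by simp) x), pd_sphereDefect_self,
      sphereDefect_self]
    ring
  have hd2 (x i j) : eta (pd2 L x i j) (unitNormal k l a b x) =
      G x * ((if k = i then 1 else 0) * (if k = j then 1 else 0) +
        (if l = i then 1 else 0) * (if l = j then 1 else 0) * cos (x k) ^ 2) := by
    rw [eta_comm, ← etaCLM_apply, ← pd2_clm_comp _ hLsmooth]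
    simp only [key]
    rw [pd2_mul_of_critical hG (contDiff_sphereDefect k l _ _) (sphereDefect_self k l x)
      (pd_sphereDefect_self k l x), pd2_sphereDefect_self]
  refine ⟨unitNormal k l a b, (contDiff_unitNormal k l a b).contDiffOn, fun x hx => ?_⟩
  refine ⟨eta_unitNormal_self hn k l hab x, ?_, hd1 x, fun i j hij => ?_, ?_, ?_, ?_⟩
  · rw [← etaCLM_apply, key, sphereDefect_self, mul_zero]
  · rw [hd2]
    have hk : ¬ (k = i ∧ k = j) := fun h => hij ⟨h.1.symm.trans h.2, Or.inl (by rw [← h.1])⟩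
    have hl : ¬ (l = i ∧ l = j) := fun h => hij ⟨h.1.symm.trans h.2, Or.inr (by rw [← h.1])⟩
    simp only [ite_zero_mul_ite_zero, if_neg hk, if_neg hl]
    ring
  · change eta (pd2 L x k k) _ = G x
    rw [hd2, if_pos rfl, if_neg hkl.symm]
    ring
  · change eta (pd2 L x l l) _ = G x * cos (x k) ^ 2
    rw [hd2, if_pos rfl, if_neg hkl]
    ring
  · rw [hU] at hx
    have hx' : 0 < a * Real.sinh (x ⟨n - 3, by omega⟩) + b * Real.cosh (x ⟨n - 3, by omega⟩) := hx
    exact (div_pos hqpos (mul_pos hx' (Finset.prod_pos fun j _ => Real.cosh_pos _))).ne'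
end
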